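/- Let k ≥ 4 and let w be a minimal uncompletable word for S_k. Let p and q be two consecutive occurrences of v in w, with p before q, and let F_p, F_q be their sets of forbidden positions. If F_q = {0} ∪ {i, i+1, …, k−2} for some 1 ≤ i ≤ k−1, then |F_p| < |F_q|. -/

import Mathlib

namespace Restivo

/-- Words over the two-letter alphabet Σ = {a, b}, encoded as lists of booleans. -/
abbrev Word := List Bool

/-- The letter `a`. -/
def a : Bool := false

/-- The letter `b`. -/
def b : Bool := true

/-- Kleene star: all finite concatenations of words from `S` (including the empty word). -/
def kstar (S : Set Word) : Set Word :=
  { w | ∃ L : List Word, (∀ x ∈ L, x ∈ S) ∧ L.flatten = w }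

/-- Prefixes of words of `L`. -/
def Pref (L : Set Word) : Set Word := { w | ∃ z : Word, w ++ z ∈ L }

/-- Factors (contiguous subwords) of words of `L`. -/
def Facts (L : Set Word) : Set Word := { w | ∃ x y : Word, x ++ w ++ y ∈ L }

/-- The word u = b a^(k-1). -/
def u (k : ℕ) : Word := b :: List.replicate (k - 1) a

/-- The word v = b^(k-1) a. -/
def v (k : ℕ) : Word := List.replicate (k - 1) b ++ [a]

/-- The set S_k = (Σ^k \ {u, v}) ∪ (Σ^(k-1) \ {a^(k-1), b^(k-1)}). -/
def Sk (k : ℕ) : Set Word :=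
  { w | w.length = k ∧ w ≠ u k ∧ w ≠ v k } ∪
  { w | w.length = k - 1 ∧ w ≠ List.replicate (k - 1) a ∧ w ≠ List.replicate (k - 1) b }

/-- Position `j` is forbidden in `w` w.r.t. `S` if the suffix of `w` starting from
position `j` is not a prefix of any word of `S*`. -/
def Forbidden (S : Set Word) (w : Word) (j : ℕ) : Prop :=
  w.drop j ∉ Pref (kstar S)

/-- The word `p` occurs in `w` at position `s`. -/
def OccursAt (p w : Word) (s : ℕ) : Prop :=
  s + p.length ≤ w.length ∧ (w.drop s).take p.length = p

/-- The set of (locally enumerated) forbidden positions of the occurrence of `p`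
at position `s` in `w`, with respect to `S_k`. -/
def Focc (k : ℕ) (w p : Word) (s : ℕ) : Set ℕ :=
  { i | i < p.length ∧ Forbidden (Sk k) w (s + i) }

/-- Two occurrences (of words from {u, v}) at positions `s < t` in `w` are
consecutive: no word from {u, v} occurs at a position strictly between them. -/
def Consecutive (k : ℕ) (w : Word) (s t : ℕ) : Prop :=
  s < t ∧ ∀ m, s < m → m < t → ¬ OccursAt (u k) w m ∧ ¬ OccursAt (v k) w m

/-- `w` is a minimal uncompletable word for `S`. -/
def MinUncompletable (S : Set Word) (w : Word) : Prop :=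
  w ∉ Facts (kstar S) ∧ ∀ w' : Word, w' ∉ Facts (kstar S) → w.length ≤ w'.length

/-- Prepending a word of `S` preserves being a prefix of a word of `S*`. -/
theorem append_mem_Pref {S : Set Word} {x y : Word} (hx : x ∈ S) (hy : y ∈ Pref (kstar S)) :
    x ++ y ∈ Pref (kstar S) := by
  obtain ⟨z, L, hL, h⟩ := hy
  refine ⟨z, x :: L, ?_, ?_⟩
  · simpa using ⟨hx, hL⟩
  · simp [h]

theorem Forbidden.add_of_take_mem {S : Set Word} {w : Word} {m l : ℕ} (h : Forbidden S w m)
    (hl : (w.drop m).take l ∈ S) : Forbidden S w (m + l) := by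
  intro h'
  apply h
  rw [← List.take_append_drop l (w.drop m), List.drop_drop]
  exact append_mem_Pref hl h'

theorem length_le_of_mem_Sk {k : ℕ} {x : Word} (hx : x ∈ Sk k) : x.length ≤ k := by
  rcases hx with h | h
  · exact h.1.le
  · exact h.1.trans_le (Nat.sub_le _ _)

/-- A concatenation of words of length at most `k` has a factorization boundary in every window
of `k` consecutive positions. -/
theorem exists_boundary {k : ℕ} (L : List Word) (hL : ∀ x ∈ L, x.length ≤ k) (p : ℕ)
    (hk : 0 < k) (hp : p ≤ L.flatten.length) :
    ∃ L₁ L₂, L = L₁ ++ L₂ ∧ p ≤ L₁.flatten.length ∧ L₁.flatten.length < p + k := by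
  induction L generalizing p with
  | nil => exact ⟨[], [], rfl, by simpa using hp, by simp; omega⟩
  | cons x L ih =>
    rcases Nat.eq_zero_or_pos p with rfl | hp0
    · exact ⟨[], x :: L, rfl, by simp, by simpa using hk⟩
    · have hx := hL x (by simp)
      obtain ⟨L₁, L₂, rfl, h₁, h₂⟩ := ih (fun y hy => hL y (by simp [hy])) (p - x.length)
        (by simp only [List.flatten_cons, List.length_append] at hp; omega)
      rcases Nat.lt_or_ge p x.length with h | h
      · exact ⟨[x], L₁ ++ L₂, rfl, by simpa using h.le, by simp; omega⟩
      · refine ⟨x :: L₁, L₂, rfl, ?_, ?_⟩ <;>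
          simp only [List.flatten_cons, List.length_append] <;> omega

/-- Replacing a suffix `y` by a suffix `y'` with the same first `k - 1` letters and at least the
same forbidden positions among the first `k` preserves uncompletability. -/
theorem not_mem_Facts_of_suffix {k : ℕ} (hk : 0 < k) {S : Set Word}
    (hS : ∀ x ∈ S, x.length ≤ k) {x y y' : Word} (h : x ++ y ∉ Facts (kstar S))
    (hlen : k - 1 ≤ y'.length) (htake : y'.take (k - 1) = y.take (k - 1))
    (hforb : ∀ j < k, Forbidden S y j → Forbidden S y' j) :
    x ++ y' ∉ Facts (kstar S) := by
  rintro ⟨X, Z, L, hL, hflat⟩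
  apply h
  obtain ⟨L₁, L₂, rfl, h₁, h₂⟩ := exists_boundary L (fun z hz => hS z (hL z hz))
    (X.length + x.length) hk (by rw [hflat]; simp)
  obtain ⟨j, hj⟩ := Nat.exists_eq_add_of_le h₁
  have hflat' : L₁.flatten ++ L₂.flatten = (X ++ x ++ y'.take j) ++ (y'.drop j ++ Z) := by
    rw [← List.flatten_append, hflat]
    simp only [List.append_assoc]
    rw [← List.append_assoc (y'.take j), List.take_append_drop]
  obtain ⟨e₁, e₂⟩ := List.append_inj hflat' (by
    simp only [List.length_append, List.length_take]; omega)
  have hy' : ¬ Forbidden S y' j := fun hf =>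
    hf ⟨Z, L₂, fun z hz => hL z (by simp [hz]), e₂⟩
  obtain ⟨Z', L₃, hL₃, e₃⟩ := not_not.mp fun hf => hy' (hforb j (by omega) hf)
  have htj : y'.take j = y.take j := by
    have := congrArg (List.take j) htake
    rwa [List.take_take, List.take_take, min_eq_left (by omega)] at this
  refine ⟨X, Z', L₁ ++ L₃, ?_, ?_⟩
  · intro z hz
    rcases List.mem_append.mp hz with hz | hz
    · exact hL z (by simp [hz])
    · exact hL₃ z hz
  · rw [List.flatten_append, e₁, e₃, htj]
    simp only [List.append_assoc]
    rw [← List.append_assoc (y.take j), List.take_append_drop]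

/-- A word starting with `b^k` has to be parsed with `b^k` as its first factor. -/
theorem forbidden_zero_of_take_eq {k : ℕ} (hk : 2 ≤ k) {y : Word}
    (hy : y.take k = List.replicate k b) (h : Forbidden (Sk k) y k) : Forbidden (Sk k) y 0 := by
  rintro ⟨z, L, hL, hflat⟩
  have hlen : k ≤ y.length := by
    have := congrArg List.length hy
    simp at this
    exact this
  rw [List.drop_zero] at hflat
  cases L with
  | nil =>
    have := congrArg List.length hflat
    simp at this
    omega
  | cons x L =>
    have hx := hL x (by simp)
    rw [List.flatten_cons] at hflat
    have hxl := length_le_of_mem_Sk hx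
    have hxt : x = List.replicate x.length b := by
      have h1 := congrArg (List.take x.length) hflat
      rw [List.take_left, List.take_append_of_le_length (by omega)] at h1
      have h2 := congrArg (List.take x.length) hy
      rw [List.take_take, min_eq_left hxl, ← h1, List.take_replicate, min_eq_left hxl] at h2
      exact h2
    rcases hx with hx | hx
    · apply h
      refine ⟨z, L, fun y hy => hL y (by simp [hy]), ?_⟩
      have h1 := congrArg (List.drop k) hflat
      rw [← hx.1, List.drop_left, List.drop_append_of_le_length (by omega)] at h1
      rw [h1, hx.1]
    · exact hx.2.2 (hx.1 ▸ hxt)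

theorem OccursAt.drop_eq {p w : Word} {s : ℕ} (h : OccursAt p w s) :
    w.drop s = p ++ w.drop (s + p.length) := by
  conv_lhs => rw [← List.take_append_drop p.length (w.drop s), h.2, List.drop_drop]

theorem length_v {k : ℕ} (hk : 0 < k) : (v k).length = k := by
  simp [v]; omega

theorem OccursAt.getElem?_v {k : ℕ} {w : Word} {s j : ℕ} (h : OccursAt (v k) w s)
    (hj : j < k - 1) : w[s + j]? = some b := by
  rw [← List.getElem?_drop, h.drop_eq, v, List.append_assoc,
    List.getElem?_append_left (by simpa using hj)]
  simp [hj]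

theorem OccursAt.getElem?_v_last {k : ℕ} {w : Word} {s : ℕ} (h : OccursAt (v k) w s) :
    w[s + (k - 1)]? = some a := by
  rw [← List.getElem?_drop, h.drop_eq, v, List.append_assoc,
    List.getElem?_append_right (by simp)]
  simp

theorem take_mem_Sk {k : ℕ} (hk : 0 < k) {w : Word} {m : ℕ} (hm : m + k ≤ w.length)
    (hu : ¬ OccursAt (u k) w m) (hv : ¬ OccursAt (v k) w m) : (w.drop m).take k ∈ Sk k := by
  have lu : (u k).length = k := by simp [u]; omega
  refine Or.inl ⟨by simp; omega, fun h => hu ⟨by omega, by rwa [lu]⟩,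
    fun h => hv ⟨by rw [length_v hk]; omega, by rwa [length_v hk]⟩⟩

/-- Between two consecutive occurrences of `v`, forbidden positions propagate by steps of `k`. -/
theorem forbidden_add_mul {k : ℕ} (hk : 0 < k) {w : Word} {s t : ℕ} (ht : t + k ≤ w.length)
    (hcons : Consecutive k w s t) (n : ℕ) {m : ℕ} (hm : s < m) (hn : m + n * k < t + k)
    (hf : Forbidden (Sk k) w m) : Forbidden (Sk k) w (m + n * k) := by
  induction n with
  | zero => simpa using hf
  | succ n ih =>
    rw [Nat.succ_mul] at hn ⊢
    have hc := hcons.2 (m + n * k) (by omega) (by omega)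
    rw [← Nat.add_assoc]
    exact (ih (by omega)).add_of_take_mem (take_mem_Sk hk (by omega) hc.1 hc.2)

theorem Consecutive.add_le {k : ℕ} {w : Word} {s t : ℕ} (hop : OccursAt (v k) w s)
    (hoq : OccursAt (v k) w t) (hk : 0 < k) (hcons : Consecutive k w s t) : s + k ≤ t := by
  by_contra! hlt
  have h1 := hop.getElem?_v_last
  have h2 := hoq.getElem?_v (j := s + (k - 1) - t) (by have := hcons.1; omega)
  rw [show t + (s + (k - 1) - t) = s + (k - 1) by omega, h1] at h2
  exact absurd h2 (by decide)

/-- A forbidden position inside an occurrence of `v`, other than its first one, also propagates by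
a step of `k - 1`. -/
theorem forbidden_add_pred {k : ℕ} (hk : 4 ≤ k) {w : Word} {s t : ℕ}
    (hop : OccursAt (v k) w s) (hoq : OccursAt (v k) w t) (hcons : Consecutive k w s t)
    {j : ℕ} (hj1 : 1 ≤ j) (hjk : j < k) (hf : Forbidden (Sk k) w (s + j)) :
    Forbidden (Sk k) w (s + j + (k - 1)) := by
  have hst := hcons.add_le hop hoq (by omega)
  have ht : t + k ≤ w.length := by have := hoq.1; rwa [length_v (by omega)] at this
  apply hf.add_of_take_mem
  have hget : ∀ l < k - 1, ((w.drop (s + j)).take (k - 1))[l]? = w[s + j + l]? := by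
    intro l hl
    rw [List.getElem?_take_of_lt hl, List.getElem?_drop]
  refine Or.inr ⟨by simp; omega, fun h => ?_, fun h => ?_⟩
  · rcases Nat.lt_or_ge j (k - 1) with hj | hj
    · have h1 := hget 0 (by omega)
      rw [h, Nat.add_zero, hop.getElem?_v hj, List.getElem?_replicate_of_lt (by omega)] at h1
      exact absurd h1 (by decide)
    · obtain rfl : j = k - 1 := by omega
      refine (hcons.2 (s + (k - 2)) (by omega) (by omega)).1 ⟨by simp [u]; omega, ?_⟩
      have hb := hop.getElem?_v (j := k - 2) (by omega)
      obtain ⟨hlt, hb⟩ := List.getElem?_eq_some_iff.mp hb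
      rw [List.drop_eq_getElem_cons hlt, hb, u, List.length_cons, List.length_replicate,
        List.take_succ_cons, show s + (k - 2) + 1 = s + (k - 1) by omega, h]
  · have h1 := hget (k - 1 - j) (by omega)
    rw [h, show s + j + (k - 1 - j) = s + (k - 1) by omega, hop.getElem?_v_last,
      List.getElem?_replicate_of_lt (by omega)] at h1
    exact absurd h1 (by decide)

/-- In a minimal uncompletable word the suffix starting at an occurrence of `v` cannot be replaced
by a shorter one that keeps `b^(k-1)` as a prefix and preserves the forbidden positions. -/
theorem MinUncompletable.exists_forbidden {k : ℕ} (hk : 0 < k) {w y' : Word}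
    (hw : MinUncompletable (Sk k) w) {s : ℕ} (hop : OccursAt (v k) w s)
    (hshort : y'.length < (w.drop s).length) (htake : y'.take (k - 1) = List.replicate (k - 1) b) :
    ∃ j ∈ Focc k w (v k) s, ¬ Forbidden (Sk k) y' j := by
  by_contra! hall
  have hlen : k - 1 ≤ y'.length := by
    have := congrArg List.length htake
    simp only [List.length_take, List.length_replicate] at this
    omega
  have hmin := hw.2 (w.take s ++ y') (not_mem_Facts_of_suffix (y := w.drop s) hk
    (fun _ => length_le_of_mem_Sk) (by rw [List.take_append_drop]; exact hw.1) hlen ?_ ?_)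
  · have := congrArg List.length (List.take_append_drop s w)
    rw [List.length_append] at hmin this
    omega
  · rw [htake, hop.drop_eq, v, List.append_assoc, List.take_left' (by simp)]
  · intro j hj hf
    refine hall j ⟨by rwa [length_v hk], ?_⟩
    rwa [Forbidden, List.drop_drop] at hf

theorem statement16 (k : ℕ) (hk : 4 ≤ k) (w : Word)
    (hw : MinUncompletable (Sk k) w)
    (s t : ℕ) (hop : OccursAt (v k) w s) (hoq : OccursAt (v k) w t)
    (hcons : Consecutive k w s t)
    (i : ℕ) (hi1 : 1 ≤ i) (hi2 : i ≤ k - 1)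
    (hFq : Focc k w (v k) t = insert 0 (Set.Icc i (k - 2))) :
    (Focc k w (v k) s).ncard < (Focc k w (v k) t).ncard := by
  have hk0 : 0 < k := by omega
  have hst := hcons.add_le hop hoq hk0
  have ht : t + k ≤ w.length := by have := hoq.1; rwa [length_v hk0] at this
  have hq : ∀ j < k, Forbidden (Sk k) w (t + j) ↔ j = 0 ∨ i ≤ j ∧ j ≤ k - 2 := by
    intro j hj
    have := Set.ext_iff.mp hFq j
    simpa [Focc, length_v hk0, hj] using this
  have hdropt : w.drop t = List.replicate (k - 1) b ++ ([a] ++ w.drop (t + k)) := by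
    rw [hoq.drop_eq, length_v hk0, v, List.append_assoc]
  have hnotsub : ¬ Focc k w (v k) s ⊆ Focc k w (v k) t := by
    intro hsub
    obtain ⟨j, hj, hf⟩ := hw.exists_forbidden hk0 hop (y' := w.drop t) (by simp; omega)
      (by rw [hdropt, List.take_left' (by simp)])
    apply hf
    rw [Forbidden, List.drop_drop]
    exact (hsub hj).2
  obtain ⟨Q, R, hR, hQR⟩ : ∃ Q R, R < k ∧ t = s + Q * k + R :=
    ⟨(t - s) / k, (t - s) % k, Nat.mod_lt _ hk0, by
      have := Nat.div_add_mod' (t - s) k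
      omega⟩
  obtain ⟨Q, rfl⟩ : ∃ Q', Q = Q' + 1 := Nat.exists_eq_succ_of_ne_zero (by
    rintro rfl
    omega)
  rw [Nat.succ_mul] at hQR
  set e : ℕ → ℕ := fun j => if R ≤ j then j - R else j + k - R with he
  have key : ∀ j ∈ Focc k w (v k) s, 1 ≤ j →
      j ≠ R ∧ i ≤ e j ∧ e j ≤ k - 2 ∧ (e j = 1 ∨ i + 1 ≤ e j) := by
    rintro j ⟨hjk, hf⟩ hj1
    rw [length_v hk0] at hjk
    have hf' := forbidden_add_pred hk hop hoq hcons hj1 hjk hf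
    have climb := fun n m => forbidden_add_mul hk0 ht hcons n (m := m)
    rcases Nat.lt_trichotomy j R with h | rfl | h
    · have c1 := climb (Q + 2) (s + j) (by omega) (by rw [Nat.add_mul]; omega) hf
      have c2 := climb (Q + 1) (s + j + (k - 1)) (by omega) (by rw [Nat.add_mul]; omega) hf'
      rw [show s + j + (Q + 2) * k = t + (j + k - R) by rw [Nat.add_mul]; omega,
        hq _ (by omega)] at c1
      rw [show s + j + (k - 1) + (Q + 1) * k = t + (j + k - R - 1) by rw [Nat.add_mul]; omega,
        hq _ (by omega)] at c2
      simp only [he, if_neg (Nat.not_le.mpr h)]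
      omega
    · have c2 := climb (Q + 1) (s + j + (k - 1)) (by omega) (by rw [Nat.add_mul]; omega) hf'
      rw [show s + j + (k - 1) + (Q + 1) * k = t + (k - 1) by rw [Nat.add_mul]; omega,
        hq _ (by omega)] at c2
      omega
    · have c1 := climb (Q + 1) (s + j) (by omega) (by rw [Nat.add_mul]; omega) hf
      have c2 := climb Q (s + j + (k - 1)) (by omega) (by omega) hf'
      rw [show s + j + (Q + 1) * k = t + (j - R) by rw [Nat.add_mul]; omega,
        hq _ (by omega)] at c1
      rw [show s + j + (k - 1) + Q * k = t + (j - R - 1) by omega, hq _ (by omega)] at c2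
      simp only [he, if_pos h.le]
      omega
  have hlt : ∀ j ∈ Focc k w (v k) s, j < k := fun j hj => by
    have := hj.1
    rwa [length_v hk0] at this
  rcases Nat.lt_or_ge 1 i with hi | hi
  · have hle : (Focc k w (v k) s).ncard ≤ (insert 0 (Set.Icc (i + 1) (k - 2))).ncard := by
      refine Set.ncard_le_ncard_of_injOn (fun j => if j = 0 then 0 else e j) ?_ ?_
        ((Set.finite_Icc _ _).insert _)
      · intro j hj
        rcases Nat.eq_zero_or_pos j with rfl | h
        · simp
        · have := key j hj h
          simp only [if_neg h.ne', Set.mem_insert_iff, Set.mem_Icc]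
          omega
      · intro j hj l hl hjl
        have hj' := key j hj
        have hl' := key l hl
        have := hlt j hj
        have := hlt l hl
        simp only [he] at hjl hj' hl'
        split_ifs at hjl hj' hl' <;> omega
    rcases Nat.lt_or_ge i (k - 1) with hik | hik
    · refine hle.trans_lt ?_
      rw [hFq]
      refine Set.ncard_lt_ncard ?_ ((Set.finite_Icc _ _).insert _)
      refine ⟨Set.insert_subset_insert (Set.Icc_subset_Icc_left (by omega)), fun h => ?_⟩
      have := h (show i ∈ insert 0 (Set.Icc i (k - 2)) from Or.inr ⟨le_rfl, by omega⟩)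
      simp only [Set.mem_insert_iff, Set.mem_Icc] at this
      omega
    · refine absurd (fun j hj => ?_) hnotsub
      rw [hFq]
      rcases Nat.eq_zero_or_pos j with rfl | h
      · simp
      · have := key j hj h
        omega
  · obtain rfl : i = 1 := by omega
    rcases Nat.lt_or_ge 1 R with h1R | hR1
    · have hsub : Focc k w (v k) s ⊆ ((Finset.range k).erase R).erase (R - 1) := by
        intro j hj
        have := hlt j hj
        have h0 := key j hj
        simp only [Finset.coe_erase, Set.mem_sdiff, Set.mem_singleton_iff, Finset.mem_coe,
          Finset.mem_range]
        simp only [he] at h0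
        split_ifs at h0 <;> omega
      have hle := Set.ncard_le_ncard hsub (Finset.finite_toSet _)
      have hq' : (Focc k w (v k) t).ncard = k - 1 := by
        have : Focc k w (v k) t = (Finset.range (k - 1) : Finset ℕ) := by
          rw [hFq]
          ext j
          simp
          omega
        rw [this, Set.ncard_coe_finset, Finset.card_range]
      rw [Set.ncard_coe_finset, Finset.card_erase_of_mem (by simp; omega),
        Finset.card_erase_of_mem (by simpa using hR), Finset.card_range] at hle
      omega
    · exfalso
      rcases Nat.eq_zero_or_pos R with rfl | hR0
      · refine hnotsub fun j hj => ?_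
        have := key j hj
        rw [hFq, Set.mem_insert_iff, Set.mem_Icc]
        simp only [he, Nat.zero_le, if_true] at this
        omega
      · obtain rfl : R = 1 := by omega
        have hbb : b :: b :: w.drop t = List.replicate (k + 1) b ++ ([a] ++ w.drop (t + k)) := by
          rw [hdropt, show k + 1 = (k - 1) + 1 + 1 by omega, List.replicate_succ,
            List.replicate_succ]
          rfl
        have htake : ∀ l ≤ k, (b :: b :: w.drop t).take l = List.replicate l b := by
          intro l hl
          rw [hbb, List.take_append_of_le_length (by simp; omega), List.take_replicate,
            min_eq_left (by omega)]
        have htwo : ∀ j, Forbidden (Sk k) (b :: b :: w.drop t) (j + 2) ↔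
            Forbidden (Sk k) w (t + j) := by
          intro j
          simp [Forbidden, List.drop_drop]
        obtain ⟨j, hj, hf⟩ := hw.exists_forbidden hk0 hop (y' := b :: b :: w.drop t)
          (by simp; omega) (htake _ (by omega))
        apply hf
        have hjk := hlt j hj
        rcases Nat.eq_zero_or_pos j with rfl | h
        · refine forbidden_zero_of_take_eq (by omega) (htake k le_rfl) ?_
          obtain ⟨l, rfl⟩ : ∃ l, k = l + 2 := ⟨k - 2, by omega⟩
          rw [htwo, hq _ (by omega)]
          omega
        · have := key j hj h
          obtain ⟨l, rfl⟩ : ∃ l, j = l + 2 := ⟨j - 2, by omega⟩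
          rw [htwo, hq _ (by omega)]
          omega

end Restivo
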